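/- Let n ≥ 1 and let π be any n-cycle in S_n. Then C(n+1, 2) · F_π(z) = Σ_{σ ∈ S_{n+1}, c(σ) ≡ n (mod 2)} z^{⌊(c(σ)−1)/2⌋}, where C(n+1,2) = (n+1)n/2 and the sum on the right runs over all permutations σ of {1,…,n+1} whose cycle count c(σ) has the same parity as n. -/

import Mathlib

open Finset Polynomial

/-- Number of cycles of a permutation, counting fixed points as cycles of length 1
(equivalently, the number of orbits). -/
noncomputable def cycleCount {α : Type*} [Fintype α] [DecidableEq α] (σ : Equiv.Perm α) : ℕ :=
  σ.cycleType.card + (Finset.univ.filter fun x => σ x = x).card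

/-- The IO-polynomial `F_π(z) = Σ_{ζ ∈ Q_n} z^⌊(c(ζπ)-1)/2⌋`, where `Q_n` is the set of
`n`-cycles of `S_n` (i.e. permutations with a single cycle), and `ζπ` applies `ζ` first
and then `π`. -/
noncomputable def IOPoly {n : ℕ} (π : Equiv.Perm (Fin n)) : Polynomial ℝ :=
  ∑ ζ ∈ Finset.univ.filter (fun ζ : Equiv.Perm (Fin n) => cycleCount ζ = 1),
    Polynomial.X ^ ((cycleCount (π * ζ) - 1) / 2)

open Equiv

theorem Equiv.Perm.sameCycle_iff_forall_mem {α : Type*} [Finite α] {σ : Perm α} {a b : α} :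
    σ.SameCycle a b ↔ ∀ A : Set α, (∀ x ∈ A, σ x ∈ A) → a ∈ A → b ∈ A := by
  constructor
  · intro h A hA ha
    obtain ⟨k, -, -, rfl⟩ := h.exists_pow_eq''
    clear h
    induction k with
    | zero => simpa
    | succ k ih => rw [pow_succ', Perm.mul_apply]; exact hA _ ih
  · intro h
    exact h {x | σ.SameCycle a x} (fun x hx => Perm.sameCycle_apply_right.2 hx) (.refl _ _)

section FullCycles

variable {α : Type*} [Fintype α] [DecidableEq α]

/-- The permutations which cyclically permute `S` and fix every point outside `S`. -/
def fullCycles (S : Finset α) : Finset (Perm α) :=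
  {σ | (∀ a ∉ S, σ a = a) ∧ ∀ a ∈ S, ∀ b ∈ S, σ.SameCycle a b}

theorem mem_fullCycles {S : Finset α} {σ : Perm α} :
    σ ∈ fullCycles S ↔ (∀ a ∉ S, σ a = a) ∧ ∀ a ∈ S, ∀ b ∈ S, σ.SameCycle a b := by
  simp [fullCycles]

theorem inv_mem_fullCycles {S : Finset α} {σ : Perm α} :
    σ⁻¹ ∈ fullCycles S ↔ σ ∈ fullCycles S := by
  simp only [mem_fullCycles, Perm.sameCycle_inv, Perm.inv_eq_iff_eq]
  simp only [eq_comm]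

theorem conj_mem_fullCycles {S : Finset α} {σ : Perm α} (g : Perm α) :
    g * σ * g⁻¹ ∈ fullCycles (S.map g.toEmbedding) ↔ σ ∈ fullCycles S := by
  simp only [mem_fullCycles, Perm.sameCycle_conj, Finset.mem_map_equiv, Perm.mul_apply]
  constructor
  · rintro ⟨h1, h2⟩
    refine ⟨fun a ha => ?_, fun a ha b hb => ?_⟩
    · simpa using h1 (g a) (by simpa using ha)
    · simpa using h2 (g a) (by simpa using ha) (g b) (by simpa using hb)
  · rintro ⟨h1, h2⟩
    refine ⟨fun a ha => ?_, fun a ha b hb => h2 _ ha _ hb⟩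
    rw [show g⁻¹ a = g.symm a from rfl, h1 _ ha, Equiv.apply_symm_apply]

theorem mul_swap_mem_fullCycles {S : Finset α} {σ : Perm α} {p x : α} (hp : p ∉ S) (hx : x ∈ S)
    (hσ : σ ∈ fullCycles S) : σ * swap p x ∈ fullCycles (insert p S) := by
  rw [mem_fullCycles] at hσ ⊢
  obtain ⟨h1, h2⟩ := hσ
  have hp' := h1 p hp
  have hpx : x ≠ p := by rintro rfl; exact hp hx
  refine ⟨fun a ha => ?_, fun a ha b hb => ?_⟩
  · rw [Finset.mem_insert, not_or] at ha
    rw [Perm.mul_apply, swap_apply_of_ne_of_ne ha.1 (by rintro rfl; exact ha.2 hx), h1 a ha.2]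
  · rw [Perm.sameCycle_iff_forall_mem]
    intro A hA haA
    have hpA : p ∈ A → σ x ∈ A := fun h => by simpa using hA p h
    have hxA : x ∈ A → p ∈ A := fun h => by simpa [hp'] using hA x h
    have key : ∀ c ∈ S, c ∈ A → ∀ d ∈ S, d ∈ A := by
      intro c hc hcA d hd
      refine (Perm.sameCycle_iff_forall_mem.1 (h2 c hc d hd) A ?_ hcA)
      intro y hy
      by_cases hyx : y = x
      · subst hyx; exact hpA (hxA hy)
      by_cases hyp : y = p
      · subst hyp; rwa [hp']
      simpa [swap_apply_of_ne_of_ne hyp hyx] using hA y hy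
    have hσx : σ x ∈ S := by
      by_contra h
      exact h (by rwa [σ.injective (h1 _ h)])
    have all : ∀ d ∈ S, d ∈ A := by
      rcases Finset.mem_insert.1 ha with rfl | ha
      · exact key _ hσx (hpA haA)
      · exact key _ ha haA
    rcases Finset.mem_insert.1 hb with rfl | hb
    · exact hxA (all x hx)
    · exact all b hb

theorem exists_mul_swap_of_mem_fullCycles {S : Finset α} {σ : Perm α} {p : α} (hp : p ∉ S)
    (hS : S.Nonempty) (hσ : σ ∈ fullCycles (insert p S)) :
    σ⁻¹ p ∈ S ∧ σ * swap p (σ⁻¹ p) ∈ fullCycles S := by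
  have hσi := inv_mem_fullCycles.2 hσ
  rw [mem_fullCycles] at hσ hσi ⊢
  obtain ⟨h1, h2⟩ := hσ
  set x := σ⁻¹ p with hx
  have hσx : σ x = p := by simp [hx]
  have hxp : x ≠ p := by
    intro h
    obtain ⟨s, hs⟩ := hS
    have := Perm.sameCycle_iff_forall_mem.1
      (h2 p (Finset.mem_insert_self _ _) s (Finset.mem_insert_of_mem hs)) {p}
      (by simpa [h] using hσx) rfl
    exact hp (by rwa [← Set.mem_singleton_iff.1 this])
  have hxS : x ∈ S := by
    by_contra h
    have := h1 x (by simp [h, hxp])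
    exact hxp (by rw [← this, hσx])
  refine ⟨hxS, fun a ha => ?_, fun a ha b hb => ?_⟩
  · by_cases hap : a = p
    · subst hap; simp [hσx]
    have hax : a ≠ x := by rintro rfl; exact ha hxS
    rw [Perm.mul_apply, swap_apply_of_ne_of_ne hap hax, h1 a (by simp [ha, hap])]
  · rw [Perm.sameCycle_iff_forall_mem]
    intro A hA haA
    have hap : a ≠ p := by rintro rfl; exact hp ha
    have hbp : b ≠ p := by rintro rfl; exact hp hb
    have := Perm.sameCycle_iff_forall_mem.1
      (h2 a (Finset.mem_insert_of_mem ha) b (Finset.mem_insert_of_mem hb))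
      {y | (y = p ∧ x ∈ A) ∨ (y ≠ p ∧ y ∈ A)} ?_ (Or.inr ⟨hap, haA⟩)
    · simpa [hbp] using this
    rintro y (⟨rfl, hy⟩ | ⟨hyp, hy⟩)
    · refine Or.inr ⟨fun h => hxp ?_, by simpa using hA x hy⟩
      exact σ.injective (hσx.trans h.symm)
    · by_cases hyx : y = x
      · subst hyx; exact Or.inl ⟨hσx, hy⟩
      · refine Or.inr ⟨fun h => hyx (σ.injective (h.trans hσx.symm)), ?_⟩
        simpa [swap_apply_of_ne_of_ne hyp hyx] using hA y hy

theorem sum_fullCycles_insert {M : Type*} [AddCommMonoid M] (F : Perm α → M) {S : Finset α} {p : α}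
    (hp : p ∉ S) (hS : S.Nonempty) :
    ∑ σ ∈ fullCycles (insert p S), F σ = ∑ x ∈ S, ∑ σ ∈ fullCycles S, F (σ * swap p x) := by
  rw [← Finset.sum_product']
  symm
  refine Finset.sum_bij' (fun xσ _ => xσ.2 * swap p xσ.1) (fun σ _ => (σ⁻¹ p, σ * swap p (σ⁻¹ p)))
    ?_ ?_ ?_ ?_ ?_
  · rintro ⟨x, σ⟩ h
    rw [Finset.mem_product] at h
    exact mul_swap_mem_fullCycles hp h.1 h.2
  · intro σ h
    rw [Finset.mem_product]
    exact exists_mul_swap_of_mem_fullCycles hp hS h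
  · rintro ⟨x, σ⟩ h
    rw [Finset.mem_product, mem_fullCycles] at h
    have : σ.symm p = p := by rw [Equiv.symm_apply_eq]; exact (h.2.1 p hp).symm
    simp [this, mul_assoc]
  · intro σ h
    simp [mul_assoc]
  · intros; rfl

theorem sum_fullCycles_inv {M : Type*} [AddCommMonoid M] (F : Perm α → M) (S : Finset α) :
    ∑ σ ∈ fullCycles S, F σ⁻¹ = ∑ σ ∈ fullCycles S, F σ :=
  Finset.sum_bij' (fun σ _ => σ⁻¹) (fun σ _ => σ⁻¹) (fun _ h => inv_mem_fullCycles.2 h)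
    (fun _ h => inv_mem_fullCycles.2 h) (by simp) (by simp) (by simp)

theorem sum_fullCycles_map {M : Type*} [AddCommMonoid M] (F : Perm α → M) (S : Finset α)
    (g : Perm α) :
    ∑ σ ∈ fullCycles (S.map g.toEmbedding), F σ = ∑ σ ∈ fullCycles S, F (g * σ * g⁻¹) := by
  symm
  refine Finset.sum_bij' (fun σ _ => g * σ * g⁻¹) (fun σ _ => g⁻¹ * σ * g)
    (fun _ h => (conj_mem_fullCycles g).2 h) (fun σ h => ?_) (by simp [mul_assoc])
    (by simp [mul_assoc]) (by simp)
  rw [← conj_mem_fullCycles g]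
  simpa [mul_assoc] using h

omit [Fintype α] in
theorem eq_one_of_forall_notMem_singleton {y : α} {σ : Perm α}
    (h : ∀ a ∉ ({y} : Finset α), σ a = a) : σ = 1 := by
  ext b
  by_cases hb : b = y
  · subst hb
    by_contra hne
    exact hne (σ.injective (h _ (by simpa using hne)))
  · exact h b (by simpa using hb)

theorem fullCycles_singleton (y : α) : fullCycles {y} = {1} := by
  ext σ
  rw [mem_fullCycles, Finset.mem_singleton]
  refine ⟨fun h => eq_one_of_forall_notMem_singleton h.1, ?_⟩
  rintro rfl
  simp

theorem card_fullCycles {S : Finset α} (hS : S.Nonempty) :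
    (fullCycles S).card = (S.card - 1).factorial := by
  induction hS using Finset.Nonempty.cons_induction with
  | singleton a => simp [fullCycles_singleton]
  | cons a S ha hS ih =>
    have := sum_fullCycles_insert (fun _ => 1) ha hS
    simp only [Finset.sum_const, smul_eq_mul, mul_one] at this
    have hpos := hS.card_pos
    rw [Finset.cons_eq_insert, this, ih, Finset.card_insert_of_notMem ha, Nat.add_sub_cancel,
      Nat.mul_factorial_pred hpos.ne']


/-- The permutations of sign `e` which fix every point outside `S`. -/
def permsOfSign (e : ℤˣ) (S : Finset α) : Finset (Perm α) :=
  {σ | (∀ a ∉ S, σ a = a) ∧ Perm.sign σ = e}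

theorem mem_permsOfSign {e : ℤˣ} {S : Finset α} {σ : Perm α} :
    σ ∈ permsOfSign e S ↔ (∀ a ∉ S, σ a = a) ∧ Perm.sign σ = e := by
  simp [permsOfSign]

theorem mul_swap_mem_permsOfSign {e : ℤˣ} {S : Finset α} {σ : Perm α} {x y : α} (hx : x ∈ S)
    (hy : y ∈ S) (hxy : x ≠ y) (hσ : σ ∈ permsOfSign e S) :
    σ * swap x y ∈ permsOfSign (-e) S := by
  rw [mem_permsOfSign] at hσ ⊢
  refine ⟨fun a ha => ?_, by simp [Perm.sign_swap hxy, hσ.2]⟩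
  rw [Perm.mul_apply, swap_apply_of_ne_of_ne (by rintro rfl; exact ha hx)
    (by rintro rfl; exact ha hy), hσ.1 a ha]

theorem sum_permsOfSign_mul_swap {M : Type*} [AddCommMonoid M] (F : Perm α → M) (e : ℤˣ)
    {S : Finset α} {x y : α} (hx : x ∈ S) (hy : y ∈ S) (hxy : x ≠ y) :
    ∑ σ ∈ permsOfSign e S, F (σ * swap x y) = ∑ σ ∈ permsOfSign (-e) S, F σ :=
  Finset.sum_bij' (fun σ _ => σ * swap x y) (fun σ _ => σ * swap x y)
    (fun _ h => mul_swap_mem_permsOfSign hx hy hxy h)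
    (fun _ h => by simpa using mul_swap_mem_permsOfSign hx hy hxy h)
    (by simp [mul_assoc]) (by simp [mul_assoc]) (by simp)

theorem sum_permsOfSign_insert {M : Type*} [AddCommMonoid M] (F : Perm α → M) (e : ℤˣ)
    {S : Finset α} {p : α} (hp : p ∉ S) :
    ∑ σ ∈ permsOfSign e (insert p S), F σ =
      ∑ σ ∈ permsOfSign e S, F σ + ∑ x ∈ S, ∑ σ ∈ permsOfSign (-e) S, F (σ * swap p x) := by
  rw [← Finset.sum_filter_add_sum_filter_not _ (fun σ : Perm α => σ p = p)]
  congr 1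
  · refine Finset.sum_congr ?_ fun _ _ => rfl
    ext σ
    simp only [Finset.mem_filter, mem_permsOfSign, Finset.mem_insert, not_or]
    constructor
    · rintro ⟨⟨h, he⟩, h'⟩
      refine ⟨fun a ha => ?_, he⟩
      by_cases hap : a = p
      · rw [hap, h']
      · exact h a ⟨hap, ha⟩
    · rintro ⟨h, he⟩
      exact ⟨⟨fun a ha => h a ha.2, he⟩, h p hp⟩
  · rw [← Finset.sum_product']
    symm
    refine Finset.sum_bij' (fun xσ _ => xσ.2 * swap p xσ.1)
      (fun σ _ => (σ⁻¹ p, σ * swap p (σ⁻¹ p))) ?_ ?_ ?_ ?_ ?_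
    · rintro ⟨x, σ⟩ h
      obtain ⟨hx, h, he⟩ := by simpa only [Finset.mem_product, mem_permsOfSign] using h
      have hpx : p ≠ x := by rintro rfl; exact hp hx
      rw [Finset.mem_filter]
      constructor
      · rw [← neg_neg e]
        refine mul_swap_mem_permsOfSign (Finset.mem_insert_self _ _) (Finset.mem_insert_of_mem hx)
          hpx (mem_permsOfSign.2 ⟨fun a ha => h a ?_, he⟩)
        exact fun h => ha (Finset.mem_insert_of_mem h)
      · intro h'
        simp only [Perm.mul_apply, swap_apply_left] at h'
        exact hpx (σ.injective ((h p hp).trans h'.symm))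
    · intro σ hσ
      obtain ⟨⟨h, he⟩, hne⟩ := by simpa only [Finset.mem_filter, mem_permsOfSign] using hσ
      have hσx : σ (σ⁻¹ p) = p := by simp
      have hpx : p ≠ σ⁻¹ p := fun h' => hne (by rw [← h'] at hσx; exact hσx)
      have hx : σ⁻¹ p ∈ S := by
        by_contra hx
        exact hpx (hσx.symm.trans (h _ (by simpa [-Perm.coe_inv, hx] using hpx.symm)))
      simp only [Finset.mem_product, mem_permsOfSign]
      refine ⟨hx, fun a ha => ?_, by rw [Perm.sign_mul, Perm.sign_swap hpx, he, mul_neg_one]⟩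
      by_cases hap : a = p
      · rw [hap, Perm.mul_apply, swap_apply_left, hσx]
      · rw [Perm.mul_apply, swap_apply_of_ne_of_ne hap (by rintro rfl; exact ha hx),
          h a (by simp [hap, ha])]
    · rintro ⟨x, σ⟩ h
      obtain ⟨hx, h, he⟩ := by simpa only [Finset.mem_product, mem_permsOfSign] using h
      have : σ.symm p = p := by rw [Equiv.symm_apply_eq]; exact (h p hp).symm
      simp [this, mul_assoc]
    · intro σ h
      simp [mul_assoc]
    · intros; rfl

section Ring

variable {R : Type*} [Ring R] (ρ : Perm α →* R)

/-- The image of the sum of all permutations which cyclically permute `S`. -/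
def cycleSum (S : Finset α) : R := ∑ σ ∈ fullCycles S, ρ σ

/-- The image of the sum of all permutations of `S` of sign `e`. -/
def signSum (e : ℤˣ) (S : Finset α) : R := ∑ σ ∈ permsOfSign e S, ρ σ

/-- The image of the sum of all transpositions exchanging `p` with an element of `S`. -/
def swapSum (p : α) (S : Finset α) : R := ∑ x ∈ S, ρ (swap p x)

theorem cycleSum_insert {S : Finset α} {p : α} (hp : p ∉ S) (hS : S.Nonempty) :
    cycleSum ρ (insert p S) = cycleSum ρ S * swapSum ρ p S := by
  simp only [cycleSum, swapSum, sum_fullCycles_insert ρ hp hS, Finset.mul_sum, Finset.sum_mul,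
    map_mul]

theorem cycleSum_insert' {S : Finset α} {p : α} (hp : p ∉ S) (hS : S.Nonempty) :
    cycleSum ρ (insert p S) = swapSum ρ p S * cycleSum ρ S := by
  have := sum_fullCycles_insert (fun σ => ρ σ⁻¹) hp hS
  rw [sum_fullCycles_inv ρ] at this
  simp only [mul_inv_rev, swap_inv, map_mul] at this
  rw [cycleSum, this, swapSum, Finset.sum_mul]
  refine Finset.sum_congr rfl fun x _ => ?_
  rw [sum_fullCycles_inv (fun σ => ρ (swap p x) * ρ σ), cycleSum, Finset.mul_sum]

theorem map_mul_cycleSum (g : Perm α) (S : Finset α) :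
    ρ g * cycleSum ρ S = cycleSum ρ (S.map g.toEmbedding) * ρ g := by
  simp only [cycleSum, sum_fullCycles_map, Finset.mul_sum, Finset.sum_mul, ← map_mul,
    inv_mul_cancel_right]

theorem map_swap_mul_cycleSum {S : Finset α} {x y : α} (hx : x ∈ S) (hy : y ∈ S) :
    ρ (swap x y) * cycleSum ρ S = cycleSum ρ S * ρ (swap x y) := by
  rw [map_mul_cycleSum]
  congr 2
  ext a
  rw [Finset.mem_map_equiv, symm_swap]
  by_cases hax : a = x
  · simp [hax, hx, hy]
  by_cases hay : a = y
  · simp [hay, hx, hy]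
  rw [swap_apply_of_ne_of_ne hax hay]

theorem map_swap_mul_cycleSum_erase {S : Finset α} {x y : α} (hx : x ∈ S) (hy : y ∈ S) :
    ρ (swap x y) * cycleSum ρ (S.erase x) = cycleSum ρ (S.erase y) * ρ (swap x y) := by
  rw [map_mul_cycleSum]
  congr 2
  ext a
  rw [Finset.mem_map_equiv, symm_swap]
  by_cases hax : a = x
  · subst hax
    by_cases h : a = y
    · simp [h]
    · simp [h, hx, Ne.symm h, hy]
  by_cases hay : a = y
  · subst hay; simp
  simp [swap_apply_of_ne_of_ne hax hay, hax, hay]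

/-- The image of the sum of all products of a cycle on all points of `S` but one and a cycle
on `S`. -/
def nearCycleProdSum (S : Finset α) : R := ∑ p ∈ S, cycleSum ρ (S.erase p) * cycleSum ρ S

omit [Fintype α] in
theorem swapSum_mul_map_swap {S : Finset α} {p r : α} (hp : p ∉ S) (hr : r ∈ S) :
    swapSum ρ p S * ρ (swap p r) = 1 + ∑ x ∈ S.erase r, ρ (swap r x) * ρ (swap p x) := by
  rw [swapSum, ← Finset.add_sum_erase _ _ hr, add_mul, ← map_mul, swap_mul_self, map_one,
    Finset.sum_mul]
  congr 1
  refine Finset.sum_congr rfl fun x hx => ?_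
  obtain ⟨hxr, hx⟩ := Finset.mem_erase.1 hx
  have hpr : p ≠ r := by rintro rfl; exact hp hr
  have hpx : p ≠ x := by rintro rfl; exact hp hx
  rw [← map_mul, ← map_mul]
  congr 1
  ext a
  simp only [Perm.mul_apply, swap_apply_def]
  grind

theorem sum_cycleSum_erase_mul_swap {S : Finset α} {p : α} (hp : p ∉ S) (hS : 2 ≤ S.card) :
    ∑ r ∈ S, cycleSum ρ (S.erase r) * cycleSum ρ S * (swapSum ρ p S * ρ (swap p r)) =
      nearCycleProdSum ρ S + cycleSum ρ S * cycleSum ρ S * swapSum ρ p S := by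
  have h2 : ∀ x ∈ S, ∑ r ∈ S.erase x, cycleSum ρ (S.erase r) * cycleSum ρ S * ρ (swap r x) =
      cycleSum ρ S * cycleSum ρ S := by
    intro x hx
    have hne : (S.erase x).Nonempty := by
      rw [← Finset.card_pos, Finset.card_erase_of_mem hx]; omega
    have := cycleSum_insert' ρ (Finset.notMem_erase x S) hne
    rw [Finset.insert_erase hx] at this
    conv_rhs => enter [1]; rw [this]
    rw [swapSum, Finset.sum_mul, Finset.sum_mul]
    refine Finset.sum_congr rfl fun r hr => ?_
    have hr := Finset.mem_of_mem_erase hr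
    rw [mul_assoc, ← map_swap_mul_cycleSum ρ hr hx, ← mul_assoc, swap_comm r x,
      map_swap_mul_cycleSum_erase ρ hx hr]
  have h3 : ∀ r ∈ S, cycleSum ρ (S.erase r) * cycleSum ρ S * (swapSum ρ p S * ρ (swap p r)) =
      cycleSum ρ (S.erase r) * cycleSum ρ S +
      ∑ x ∈ S.erase r, cycleSum ρ (S.erase r) * cycleSum ρ S * ρ (swap r x) * ρ (swap p x) := by
    intro r hr
    rw [swapSum_mul_map_swap ρ hp hr, mul_add, mul_one, Finset.mul_sum]
    simp only [mul_assoc]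
  rw [Finset.sum_congr rfl h3, Finset.sum_add_distrib, nearCycleProdSum]
  congr 1
  rw [Finset.sum_comm' (t' := S) (s' := fun x => S.erase x)]
  · rw [swapSum, Finset.mul_sum]
    refine Finset.sum_congr rfl fun x hx => ?_
    rw [← Finset.sum_mul, h2 x hx]
  · intro x y
    simp only [Finset.mem_erase]
    grind

theorem nearCycleProdSum_insert {S : Finset α} {p : α} (hp : p ∉ S) (hS : 2 ≤ S.card) :
    nearCycleProdSum ρ (insert p S) =
      nearCycleProdSum ρ S * (swapSum ρ p S * swapSum ρ p S - 1) := by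
  have hne : S.Nonempty := by rw [← Finset.card_pos]; omega
  have h1 : ∀ r ∈ S, cycleSum ρ ((insert p S).erase r) * cycleSum ρ (insert p S) =
      cycleSum ρ (S.erase r) * cycleSum ρ S * (swapSum ρ p S * swapSum ρ p S) -
      cycleSum ρ (S.erase r) * cycleSum ρ S * (swapSum ρ p S * ρ (swap p r)) := by
    intro r hr
    have hpr : p ≠ r := by rintro rfl; exact hp hr
    have hner : (S.erase r).Nonempty := by
      rw [← Finset.card_pos, Finset.card_erase_of_mem hr]; omega
    have hX : swapSum ρ p (S.erase r) = swapSum ρ p S - ρ (swap p r) := by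
      rw [swapSum, swapSum, Finset.sum_erase_eq_sub hr]
    have hc : swapSum ρ p (S.erase r) * cycleSum ρ (insert p S) =
        cycleSum ρ (insert p S) * swapSum ρ p (S.erase r) := by
      rw [swapSum, Finset.sum_mul, Finset.mul_sum]
      refine Finset.sum_congr rfl fun x hx => map_swap_mul_cycleSum ρ
        (Finset.mem_insert_self _ _) (Finset.mem_insert_of_mem (Finset.mem_of_mem_erase hx))
    rw [Finset.erase_insert_of_ne hpr,
      cycleSum_insert ρ (fun h => hp (Finset.mem_of_mem_erase h)) hner, mul_assoc, hc,
      cycleSum_insert ρ hp hne, hX]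
    noncomm_ring
  rw [nearCycleProdSum, Finset.sum_insert hp, Finset.sum_congr rfl h1, Finset.sum_sub_distrib,
    sum_cycleSum_erase_mul_swap ρ hp hS, Finset.erase_insert hp, cycleSum_insert ρ hp hne,
    ← Finset.sum_mul]
  change _ + (nearCycleProdSum ρ S * _ - _) = _
  noncomm_ring

theorem signSum_insert (e : ℤˣ) {S : Finset α} {p : α} (hp : p ∉ S) :
    signSum ρ e (insert p S) = signSum ρ e S + signSum ρ (-e) S * swapSum ρ p S := by
  simp only [signSum, swapSum, sum_permsOfSign_insert ρ e hp, Finset.mul_sum, Finset.sum_mul,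
    map_mul]

theorem signSum_mul_swap (e : ℤˣ) {S : Finset α} {x y : α} (hx : x ∈ S) (hy : y ∈ S)
    (hxy : x ≠ y) : signSum ρ e S * ρ (swap x y) = signSum ρ (-e) S := by
  simp only [signSum, Finset.sum_mul, ← map_mul, sum_permsOfSign_mul_swap ρ e hx hy hxy]

theorem signSum_mul_swapSum_mul_swapSum (e : ℤˣ) {S : Finset α} {p : α} (hp : p ∉ S) :
    signSum ρ e S * (swapSum ρ p S * swapSum ρ p S) =
      S.card • signSum ρ e S + (S.card - 1) • (signSum ρ (-e) S * swapSum ρ p S) := by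
  rw [swapSum.eq_def ρ p S, Finset.mul_sum, ← swapSum]
  rw [Finset.sum_congr rfl fun r hr => swapSum_mul_map_swap ρ hp hr, Finset.sum_add_distrib,
    mul_add, Finset.sum_const, mul_smul_comm, mul_one]
  congr 1
  rw [Finset.sum_comm' (t' := S) (s' := fun x => S.erase x)
    (by intro x y; simp only [Finset.mem_erase]; grind), Finset.mul_sum, swapSum, Finset.mul_sum,
    Finset.smul_sum]
  refine Finset.sum_congr rfl fun x hx => ?_
  rw [Finset.mul_sum, ← Finset.card_erase_of_mem hx, ← Finset.sum_const]
  refine Finset.sum_congr rfl fun r hr => ?_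
  obtain ⟨hrx, hr⟩ := Finset.mem_erase.1 hr
  rw [← mul_assoc, signSum_mul_swap ρ e hr hx hrx]

theorem cycleSum_singleton (y : α) : cycleSum ρ {y} = 1 := by
  simp [cycleSum, fullCycles_singleton]

theorem permsOfSign_one_singleton (y : α) : permsOfSign 1 {y} = {1} := by
  ext σ
  rw [mem_permsOfSign, Finset.mem_singleton]
  refine ⟨fun h => eq_one_of_forall_notMem_singleton h.1, ?_⟩
  rintro rfl
  simp

theorem permsOfSign_neg_one_singleton (y : α) : permsOfSign (-1) {y} = ∅ := by
  refine Finset.eq_empty_of_forall_notMem fun σ h => ?_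
  rw [mem_permsOfSign] at h
  have := h.2
  rw [eq_one_of_forall_notMem_singleton h.1, Perm.sign_one] at this
  exact absurd this (by decide)

/-- Every odd permutation of `S` is in `2 (|S| - 2)!` ways a product of a cycle on all points of
`S` but one and a cycle on `S`. -/
theorem nearCycleProdSum_eq {S : Finset α} (hS : 2 ≤ S.card) :
    nearCycleProdSum ρ S = (2 * (S.card - 2).factorial) • signSum ρ (-1) S := by
  induction S using Finset.induction_on with
  | empty => simp at hS
  | insert p S hp ih =>
    rw [Finset.card_insert_of_notMem hp] at hS
    obtain hS | hS : S.card = 1 ∨ 2 ≤ S.card := by omega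
    · obtain ⟨y, rfl⟩ := Finset.card_eq_one.1 hS
      have hpy : p ≠ y := by simpa using hp
      have h1 : cycleSum ρ (insert p {y}) = ρ (swap p y) := by
        rw [cycleSum_insert ρ hp (Finset.singleton_nonempty y), cycleSum_singleton, swapSum,
          Finset.sum_singleton, one_mul]
      have h2 : (insert p {y} : Finset α).erase y = {p} := by
        rw [Finset.erase_insert_of_ne hpy]; simp
      rw [nearCycleProdSum, Finset.sum_insert hp, Finset.sum_singleton, h1, h2,
        Finset.erase_insert hp, cycleSum_singleton, cycleSum_singleton, signSum_insert ρ _ hp,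
        signSum, signSum, neg_neg, permsOfSign_one_singleton, permsOfSign_neg_one_singleton,
        swapSum]
      simp [hpy, two_mul]
    · obtain ⟨m, hm⟩ := Nat.exists_eq_add_of_le' hS
      rw [nearCycleProdSum_insert ρ hp hS, ih hS, smul_mul_assoc, mul_sub, mul_one,
        signSum_mul_swapSum_mul_swapSum ρ _ hp, signSum_insert ρ _ hp,
        Finset.card_insert_of_notMem hp, hm, show m + 2 + 1 - 2 = m + 1 by omega,
        Nat.add_sub_cancel, show m + 2 - 1 = m + 1 by omega, Nat.factorial_succ]
      simp only [← Nat.cast_smul_eq_nsmul ℤ]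
      push_cast
      module

end Ring

/-- The right regular action of permutations on functions. -/
def rightTranslation (M : Type*) [AddCommGroup M] : Perm α →* Module.End ℤ (Perm α → M) where
  toFun σ :=
    { toFun := fun f g => f (g * σ)
      map_add' := fun _ _ => rfl
      map_smul' := fun _ _ => rfl }
  map_one' := by ext; simp
  map_mul' σ τ := by
    refine LinearMap.ext fun f => funext fun g => ?_
    exact congrArg f (mul_assoc g σ τ).symm

theorem sum_fullCycles_erase_mul_fullCycles {M : Type*} [AddCommGroup M] (F : Perm α → M)
    {S : Finset α} (hS : 2 ≤ S.card) :
    ∑ p ∈ S, ∑ σ ∈ fullCycles (S.erase p), ∑ τ ∈ fullCycles S, F (σ * τ) =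
      (2 * (S.card - 2).factorial) • ∑ σ ∈ permsOfSign (-1) S, F σ := by
  have := congrArg (fun T => T F 1) (nearCycleProdSum_eq (rightTranslation M) hS)
  simp only [nearCycleProdSum, cycleSum, signSum, Finset.sum_mul_sum, rightTranslation,
    MonoidHom.coe_mk, OneHom.coe_mk, LinearMap.sum_apply, Finset.sum_apply, Module.End.mul_apply,
    LinearMap.coe_mk, AddHom.coe_mk, LinearMap.smul_apply, Pi.smul_apply, one_mul] at this
  exact this

theorem isConj_of_mem_fullCycles {σ τ : Perm α} (hσ : σ ∈ fullCycles Finset.univ)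
    (hτ : τ ∈ fullCycles Finset.univ) : IsConj σ τ := by
  cases subsingleton_or_nontrivial α with
  | inl h => rw [Subsingleton.elim σ τ]
  | inr h =>
    have key : ∀ {σ : Perm α}, σ ∈ fullCycles Finset.univ →
        σ.support = Finset.univ ∧ σ.IsCycle := by
      intro σ hσ
      rw [mem_fullCycles] at hσ
      have hne : ∀ x, σ x ≠ x := by
        intro x hx
        obtain ⟨y, hy⟩ := exists_ne x
        exact hy ((hσ.2 x (by simp) y (by simp)).eq_of_left hx).symm
      obtain ⟨x⟩ := (inferInstance : Nonempty α)
      exact ⟨by ext; simp [hne], x, hne x, fun y _ => hσ.2 x (by simp) y (by simp)⟩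
    obtain ⟨h1, h2⟩ := key hσ
    obtain ⟨h3, h4⟩ := key hτ
    exact h2.isConj h4 (by rw [h1, h3])

end FullCycles

section CycleCount

variable {α β : Type*} [Fintype α] [DecidableEq α] [Fintype β] [DecidableEq β]

theorem cycleCount_eq_card_quotient (σ : Perm α) :
    cycleCount σ = Nat.card (Quotient (Perm.SameCycle.setoid σ)) := by
  classical
  let g : α → σ.cycleFactorsFinset ⊕ {x // σ x = x} := fun x =>
    if h : σ x = x then .inr ⟨x, h⟩
    else .inl ⟨σ.cycleOf x, Perm.cycleOf_mem_cycleFactorsFinset_iff.2 (Perm.mem_support.2 h)⟩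
  have hg : Function.Surjective g := by
    rintro (⟨c, hc⟩ | ⟨x, hx⟩)
    · obtain ⟨hc1, hc2⟩ := Perm.mem_cycleFactorsFinset_iff.1 hc
      obtain ⟨x, hx⟩ := hc1.nonempty_support
      have hx' : ¬ σ x = x := by
        rw [← hc2 x hx]; exact Perm.mem_support.1 hx
      refine ⟨x, ?_⟩
      simp only [g, hx', dite_false, Sum.inl.injEq, Subtype.mk.injEq]
      exact (Perm.cycle_is_cycleOf hx hc).symm
    · exact ⟨x, by simp [g, hx]⟩
  have hker : Perm.SameCycle.setoid σ = Setoid.ker g := by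
    ext x y
    rw [Setoid.ker_def]
    change σ.SameCycle x y ↔ _
    by_cases hx : σ x = x
    · by_cases hy : σ y = y
      · simp only [g, hx, hy, dite_true, Sum.inr.injEq, Subtype.mk.injEq]
        exact ⟨fun h => h.eq_of_left hx, fun h => h ▸ .refl _ _⟩
      · simp only [g, hx, hy, dite_true, dite_false, reduceCtorEq, iff_false]
        exact fun h => hy (h.apply_eq_self_iff.1 hx)
    · by_cases hy : σ y = y
      · simp only [g, hx, hy, dite_true, dite_false, reduceCtorEq, iff_false]
        exact fun h => hx (h.apply_eq_self_iff.2 hy)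
      · simp only [g, hx, hy, dite_false, Sum.inl.injEq, Subtype.mk.injEq]
        exact (Perm.sameCycle_iff_cycleOf_eq_of_mem_support (Perm.mem_support.2 hx)
          (Perm.mem_support.2 hy))
  rw [hker, Nat.card_congr (Setoid.quotientKerEquivOfSurjective g hg), Nat.card_eq_fintype_card,
    Fintype.card_sum, Fintype.card_coe, Fintype.card_subtype, cycleCount, Perm.cycleType_def,
    Multiset.card_map]
  rfl

theorem cycleCount_eq_of_sameCycle_iff {σ : Perm α} {τ : Perm β} (f : α → β)
    (h : ∀ a b, σ.SameCycle a b ↔ τ.SameCycle (f a) (f b))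
    (hf : ∀ y, ∃ a, τ.SameCycle (f a) y) : cycleCount σ = cycleCount τ := by
  rw [cycleCount_eq_card_quotient, cycleCount_eq_card_quotient]
  refine Nat.card_eq_of_bijective (Quotient.map f fun a b => (h a b).1) ⟨?_, ?_⟩
  · rintro ⟨a⟩ ⟨b⟩ hab
    exact Quotient.sound ((h a b).2 (Quotient.exact hab))
  · rintro ⟨y⟩
    obtain ⟨a, ha⟩ := hf y
    exact ⟨⟦a⟧, Quotient.sound ha⟩

theorem cycleCount_permCongr (e : α ≃ β) (σ : Perm α) :
    cycleCount (e.permCongr σ) = cycleCount σ := by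
  refine (cycleCount_eq_of_sameCycle_iff e (fun a b => ?_) fun y =>
    ⟨e.symm y, by simp [Perm.SameCycle.refl]⟩).symm
  rw [Perm.sameCycle_iff_forall_mem, Perm.sameCycle_iff_forall_mem]
  constructor
  · intro h A hA ha
    exact h (e ⁻¹' A) (fun x hx => by simpa using hA _ hx) ha
  · intro h A hA ha
    simpa using h (e.symm ⁻¹' A) (fun x hx => by simpa using hA _ hx) (by simpa)

theorem cycleCount_conj (g σ : Perm α) : cycleCount (g * σ * g⁻¹) = cycleCount σ :=
  cycleCount_permCongr g σ

theorem cycleCount_optionCongr_mul_swap (τ : Perm α) (x : α) :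
    cycleCount (optionCongr τ * swap none (some x)) = cycleCount τ := by
  set σ := optionCongr τ * swap none (some x) with hσ
  have h1 : σ (some x) = none := by simp [hσ]
  have h2 : σ none = some (τ x) := by simp [hσ]
  have h3 : ∀ a ≠ x, σ (some a) = some (τ a) := by
    intro a ha
    rw [hσ, Perm.mul_apply, swap_apply_of_ne_of_ne (by simp) (by simpa using ha)]
    simp
  refine (cycleCount_eq_of_sameCycle_iff some (fun a b => ?_) ?_).symm
  · rw [Perm.sameCycle_iff_forall_mem, Perm.sameCycle_iff_forall_mem]
    constructor
    · intro h A hA ha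
      refine h (some ⁻¹' A) (fun y hy => ?_) ha
      by_cases hyx : y = x
      · subst hyx
        have := hA _ (hA _ hy)
        rwa [h1, h2] at this
      · have := hA _ hy
        rwa [h3 y hyx] at this
    · intro h A hA ha
      refine h {y | y.elim (x ∈ A) (· ∈ A)} (fun y hy => ?_) ha
      rcases y with _ | y
      · rw [Set.mem_ofPred_eq, h2]; exact hA _ hy
      by_cases hyx : y = x
      · subst hyx
        rw [Set.mem_ofPred_eq, h1]; exact hy
      · rw [Set.mem_ofPred_eq, h3 y hyx]; exact hA _ hy
  · rintro (_ | y)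
    · exact ⟨x, h1 ▸ Perm.sameCycle_apply_right.2 (.refl _ _)⟩
    · exact ⟨y, .refl _ _⟩

theorem cycleCount_eq_one_iff [Nonempty α] {σ : Perm α} :
    cycleCount σ = 1 ↔ σ ∈ fullCycles Finset.univ := by
  rw [cycleCount_eq_card_quotient, Nat.card_eq_one_iff_unique, mem_fullCycles]
  constructor
  · rintro ⟨h, -⟩
    exact ⟨by simp, fun a _ b _ => Quotient.exact
      (Subsingleton.elim (Quotient.mk (Perm.SameCycle.setoid σ) a) (Quotient.mk _ b))⟩
  · rintro ⟨-, h⟩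
    refine ⟨⟨?_⟩, ⟨Quotient.mk _ (Classical.arbitrary α)⟩⟩
    rintro ⟨a⟩ ⟨b⟩
    exact Quotient.sound (h a (by simp) b (by simp))

theorem sign_eq_neg_one_iff_cycleCount (σ : Perm α) :
    Perm.sign σ = -1 ↔ cycleCount σ % 2 = (Fintype.card α + 1) % 2 := by
  have h1 : cycleCount σ + σ.support.card = σ.cycleType.card + Fintype.card α := by
    have := Finset.card_filter_add_card_filter_not (s := (Finset.univ : Finset α)) (fun x => σ x = x)
    rw [Finset.card_univ] at this
    have h : σ.support = Finset.univ.filter (fun x => ¬ σ x = x) := by ext; simp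
    rw [cycleCount, h]; omega
  rw [Perm.sign_of_cycleType, Perm.sum_cycleType, neg_one_pow_eq_neg_one_iff_odd (by decide),
    Nat.odd_iff]
  omega

theorem sum_fullCycles_option {M : Type*} [AddCommMonoid M] (F : Perm (Option α) → M) :
    ∑ σ ∈ fullCycles (Finset.univ.erase none), F σ =
      ∑ τ ∈ fullCycles (Finset.univ : Finset α), F (optionCongr τ) := by
  have key : ∀ τ : Perm α, optionCongr τ ∈ fullCycles (Finset.univ.erase none) ↔
      τ ∈ fullCycles Finset.univ := by
    intro τ
    have h : ∀ a b, Perm.SameCycle (optionCongr τ) (some a) (some b) ↔ τ.SameCycle a b := by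
      intro a b
      rw [Perm.sameCycle_iff_forall_mem, Perm.sameCycle_iff_forall_mem]
      constructor
      · intro h A hA ha
        refine h {y | y.elim True (· ∈ A)} ?_ ha
        rintro (_ | y) hy
        · exact hy
        · exact hA y hy
      · intro h A hA ha
        exact h (some ⁻¹' A) (fun y hy => hA _ hy) ha
    simp [mem_fullCycles, Option.forall, h]
  symm
  refine Finset.sum_bij (fun τ _ => optionCongr τ) (fun τ h => (key τ).2 h) ?_ ?_ (by simp)
  · intro τ _ τ' _ h
    exact Equiv.optionCongr_injective h
  · intro σ hσ
    have h0 : σ none = none := (mem_fullCycles.1 hσ).1 none (by simp)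
    have h1 : (removeNone σ).optionCongr = σ := by
      rw [map_equiv_removeNone, h0, swap_self]; rfl
    exact ⟨removeNone σ, (key _).1 (h1.symm ▸ hσ), h1⟩

/-- If `F` is a class function on permutations of `Option α` which restricts to `G`, the products
of a fixed cycle with all the other cycles on `α` compute the sum of `F` over all odd
permutations. -/
theorem sum_sign_eq_neg_one {M : Type*} [AddCommGroup M] [Nonempty α] (F : Perm (Option α) → M)
    (G : Perm α → M) (hF : ∀ g σ, F (g * σ * g⁻¹) = F σ) (hG : ∀ g σ, G (g * σ * g⁻¹) = G σ)
    (hFG : ∀ τ x, F (optionCongr τ * swap none (some x)) = G τ) {π : Perm α}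
    (hπ : π ∈ fullCycles Finset.univ) :
    (2 * (Fintype.card α - 1).factorial) • ∑ σ with Perm.sign σ = -1, F σ =
      ((Fintype.card α + 1) * Fintype.card α * (Fintype.card α - 1).factorial) •
        ∑ ζ ∈ fullCycles Finset.univ, G (π * ζ) := by
  have hpos : 0 < Fintype.card α := Fintype.card_pos
  have h := sum_fullCycles_erase_mul_fullCycles F (S := Finset.univ) (by
    rw [Finset.card_univ, Fintype.card_option]; omega)
  rw [Finset.card_univ, Fintype.card_option, show Fintype.card α + 1 - 2 = Fintype.card α - 1 by
    omega, show permsOfSign (-1) (Finset.univ : Finset (Option α)) =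
      Finset.univ.filter (fun σ => Perm.sign σ = -1) by
    ext; simp [mem_permsOfSign]] at h
  have hsym : ∀ p : Option α,
      ∑ σ ∈ fullCycles (Finset.univ.erase p), ∑ τ ∈ fullCycles Finset.univ, F (σ * τ) =
      ∑ σ ∈ fullCycles (Finset.univ.erase none), ∑ τ ∈ fullCycles Finset.univ, F (σ * τ) := by
    intro p
    have h1 : Finset.univ.erase p = (Finset.univ.erase none).map (swap none p).toEmbedding := by
      ext a
      simp
    have h2 : (Finset.univ : Finset (Option α)) = Finset.univ.map (swap none p).toEmbedding := by
      simp
    rw [h1, sum_fullCycles_map]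
    refine Finset.sum_congr rfl fun σ _ => ?_
    conv_lhs => rw [h2, sum_fullCycles_map]
    refine Finset.sum_congr rfl fun τ _ => ?_
    rw [_root_.conj_mul, hF]
  have hG' : ∀ π' ∈ fullCycles (Finset.univ : Finset α),
      ∑ ζ ∈ fullCycles Finset.univ, G (π' * ζ) = ∑ ζ ∈ fullCycles Finset.univ, G (π * ζ) := by
    intro π' hπ'
    obtain ⟨g, rfl⟩ := isConj_iff.1 (isConj_of_mem_fullCycles hπ hπ')
    have h2 : (Finset.univ : Finset α) = Finset.univ.map g.toEmbedding := by simp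
    conv_lhs => rw [h2, sum_fullCycles_map]
    refine Finset.sum_congr rfl fun τ _ => ?_
    rw [_root_.conj_mul, hG]
  have hmerge : ∀ τ : Perm α, ∑ γ ∈ fullCycles Finset.univ, F (optionCongr τ * γ) =
      Fintype.card α • ∑ ζ ∈ fullCycles Finset.univ, G (τ * ζ) := by
    intro τ
    rw [← Finset.insert_erase (Finset.mem_univ (none : Option α)),
      sum_fullCycles_insert _ (Finset.notMem_erase _ _)
        ⟨some (Classical.arbitrary α), by simp⟩,
      show (Finset.univ.erase none : Finset (Option α)) = Finset.univ.map .some by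
        ext (_ | a) <;> simp, Finset.sum_map, ← Finset.card_univ, ← Finset.sum_const]
    refine Finset.sum_congr rfl fun x _ => ?_
    rw [show (Finset.univ.map .some : Finset (Option α)) = Finset.univ.erase none by
        ext (_ | a) <;> simp, sum_fullCycles_option]
    refine Finset.sum_congr rfl fun ζ _ => ?_
    rw [← hFG (τ * ζ) x, ← mul_assoc]
    congr 2
    ext (_ | a) <;> simp
  rw [← h, Finset.sum_congr rfl fun p _ => hsym p, Finset.sum_const, sum_fullCycles_option,
    Finset.sum_congr rfl fun τ _ => hmerge τ, ← Finset.smul_sum, Finset.sum_congr rfl hG',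
    Finset.sum_const, card_fullCycles Finset.univ_nonempty, Finset.card_univ, Finset.card_univ,
    Fintype.card_option, smul_smul, smul_smul]

end CycleCount

/-- For an `n`-cycle `π`, `C(n+1,2)·F_π(z) = Σ z^⌊(c(σ)-1)/2⌋`, summed over all
permutations `σ` of `{1,…,n+1}` whose cycle count has the same parity as `n`. -/
theorem stmt_8 (n : ℕ) (hn : 1 ≤ n) (π : Equiv.Perm (Fin n)) (hπ : cycleCount π = 1) :
    ((n + 1).choose 2 : ℕ) • IOPoly π =
      ∑ σ ∈ Finset.univ.filter
          (fun σ : Equiv.Perm (Fin (n + 1)) => cycleCount σ % 2 = n % 2),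
        (Polynomial.X : Polynomial ℝ) ^ ((cycleCount σ - 1) / 2) := by
  have : Nonempty (Fin n) := ⟨⟨0, hn⟩⟩
  have h := sum_sign_eq_neg_one
    (fun σ : Perm (Option (Fin n)) => (X : ℝ[X]) ^ ((cycleCount σ - 1) / 2))
    (fun σ : Perm (Fin n) => (X : ℝ[X]) ^ ((cycleCount σ - 1) / 2))
    (fun g σ => by rw [cycleCount_conj]) (fun g σ => by rw [cycleCount_conj])
    (fun τ x => by rw [cycleCount_optionCongr_mul_swap]) (cycleCount_eq_one_iff.1 hπ)
  have hpoly : IOPoly π =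
      ∑ ζ ∈ fullCycles Finset.univ, (X : ℝ[X]) ^ ((cycleCount (π * ζ) - 1) / 2) :=
    Finset.sum_congr (by ext; simp [cycleCount_eq_one_iff]) fun _ _ => rfl
  have hodd : ∑ σ : Perm (Option (Fin n)) with Perm.sign σ = -1,
      (X : ℝ[X]) ^ ((cycleCount σ - 1) / 2) =
      ∑ σ ∈ Finset.univ.filter (fun σ : Equiv.Perm (Fin (n + 1)) => cycleCount σ % 2 = n % 2),
        (X : ℝ[X]) ^ ((cycleCount σ - 1) / 2) := by
    symm
    refine Finset.sum_equiv (finSuccEquiv n).permCongr (fun σ => ?_) fun σ _ => ?_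
    · simp only [Finset.mem_filter, Finset.mem_univ, true_and, sign_eq_neg_one_iff_cycleCount,
        cycleCount_permCongr, Fintype.card_option, Fintype.card_fin]
      omega
    · rw [cycleCount_permCongr]
  rw [hodd, ← hpoly, Fintype.card_fin, show (n + 1) * n = 2 * (n + 1).choose 2 by
    rw [Nat.choose_two_right, Nat.add_sub_cancel, Nat.mul_div_cancel']
    rw [mul_comm]; exact (Nat.even_mul_succ_self n).two_dvd] at h
  refine smul_right_injective ℝ[X] (r := 2 * (n - 1).factorial) (by positivity) ?_
  simp only [h, smul_smul]
  congr 1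
  ring
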